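/- Let A be a finite-dimensional associative unital (right) H-comodule algebra over a field F, where H is an involutory Hopf algebra (S ∘ S = id_H). Suppose that either char F = 0 or char F > dim_F A. Then the Jacobson radical J(A) is an H-subcomodule of A, i.e. ρ(J(A)) is contained in the canonical image of J(A) ⊗_F H in A ⊗_F H. -/

import Mathlib

open TensorProduct

/-- A submodule `V` of a (right) `H`-comodule `A` with structure map `ρ` is an `H`-subcomodule
if `ρ(V)` is contained in the canonical image of `V ⊗[F] H` in `A ⊗[F] H`. -/
def IsSubcomodule {F : Type*} [Field F] {A H : Type*}
    [AddCommGroup A] [Module F A] [AddCommGroup H] [Module F H]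
    (ρ : A →ₗ[F] A ⊗[F] H) (V : Submodule F A) : Prop :=
  ∀ v ∈ V, ρ v ∈ LinearMap.range (LinearMap.rTensor H V.subtype)

section TraceForm

variable {F A : Type*} [Field F] [Ring A] [Algebra F A]

/-- The regular trace of `a`: the trace of left multiplication by `a` on `A`. -/
noncomputable def regularTrace (F A : Type*) [Field F] [Ring A] [Algebra F A] : A →ₗ[F] F :=
  LinearMap.trace F A ∘ₗ (Algebra.lmul F A).toLinearMap

lemma regularTrace_apply (a : A) :
    regularTrace F A a = LinearMap.trace F A (Algebra.lmul F A a) := rfl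

lemma regularTrace_mul_comm (a b : A) : regularTrace F A (a * b) = regularTrace F A (b * a) := by
  rw [regularTrace_apply, regularTrace_apply, map_mul (Algebra.lmul F A), map_mul (Algebra.lmul F A),
    LinearMap.trace_mul_comm]

lemma regularTrace_eq_zero_of_isNilpotent {a : A} (ha : IsNilpotent a) :
    regularTrace F A a = 0 :=
  (LinearMap.isNilpotent_trace_of_isNilpotent (ha.map (Algebra.lmul F A))).eq_zero

/-- Every integral non-nilpotent element of an algebra has a nonzero idempotent multiple. -/
lemma exists_isIdempotentElem_mul {a : A} (ha : IsIntegral F a) (hn : ¬ IsNilpotent a) :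
    ∃ c : A, IsIdempotentElem (c * a) ∧ c * a ≠ 0 := by
  obtain ⟨q, hq, hdvd⟩ := Polynomial.exists_eq_pow_rootMultiplicity_mul_and_not_dvd
    (minpoly F a) (minpoly.ne_zero ha) 0
  set k := (minpoly F a).rootMultiplicity 0
  rw [map_zero, sub_zero] at hq hdvd
  obtain ⟨u, v, huv⟩ : IsCoprime (Polynomial.X ^ (k + 1)) q :=
    ((Polynomial.irreducible_X.coprime_iff_not_dvd).2 hdvd).pow_left
  have h0 : a ^ k * Polynomial.aeval a q = 0 := by
    simpa using congr(Polynomial.aeval a $hq).symm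
  have h1 : Polynomial.aeval a u * a ^ (k + 1) +
      Polynomial.aeval a v * Polynomial.aeval a q = 1 := by
    simpa using congr(Polynomial.aeval a $huv)
  have hcomm (p r : Polynomial F) : Polynomial.aeval a p * Polynomial.aeval a r =
      Polynomial.aeval a r * Polynomial.aeval a p := by
    rw [← map_mul, mul_comm, map_mul]
  have h2 : a ^ k * (Polynomial.aeval a v * Polynomial.aeval a q) = 0 := by
    rw [hcomm v q, ← mul_assoc, h0, zero_mul]
  refine ⟨Polynomial.aeval a u * a ^ k, ?_, fun h => hn ⟨k, ?_⟩⟩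
  · rw [mul_assoc, ← pow_succ]
    have h3 : Polynomial.aeval a u * a ^ (k + 1) *
        (Polynomial.aeval a v * Polynomial.aeval a q) = 0 := by
      rw [pow_succ', mul_assoc, mul_assoc, h2, mul_zero, mul_zero]
    have h4 := congr(Polynomial.aeval a u * a ^ (k + 1) * $h1)
    rwa [mul_add, h3, add_zero, mul_one] at h4
  · rw [mul_assoc, ← pow_succ] at h
    rw [h, zero_add] at h1
    rwa [h1, mul_one] at h2

variable [FiniteDimensional F A]

lemma regularTrace_mul_eq_zero_of_mem_jacobson {a : A} (ha : a ∈ (⊥ : Ideal A).jacobson) (b : A) :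
    regularTrace F A (a * b) = 0 := by
  have : IsArtinianRing A := IsArtinianRing.of_finite F A
  obtain ⟨n, hn⟩ := IsArtinianRing.isNilpotent_jacobson_bot (R := A)
  rw [regularTrace_mul_comm]
  refine regularTrace_eq_zero_of_isNilpotent ⟨n, ?_⟩
  have := Ideal.pow_mem_pow (Ideal.mul_mem_left _ b ha) n
  rwa [hn] at this

/-- A nonzero idempotent has nonzero regular trace in large or zero characteristic. -/
lemma eq_zero_of_isIdempotentElem_of_regularTrace_eq_zero
    (hchar : ringChar F = 0 ∨ Module.finrank F A < ringChar F) {e : A}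
    (he : IsIdempotentElem e) (ht : regularTrace F A e = 0) : e = 0 := by
  have hproj := LinearMap.IsIdempotentElem.isProj_range _ (he.map (Algebra.lmul F A))
  rw [regularTrace_apply, hproj.trace, ringChar.spec] at ht
  have hle := Submodule.finrank_le (LinearMap.range (Algebra.lmul F A e))
  have h0 : Module.finrank F (LinearMap.range (Algebra.lmul F A e)) = 0 := by
    rcases hchar with h | h
    · rwa [h, zero_dvd_iff] at ht
    · exact Nat.eq_zero_of_dvd_of_lt ht (hle.trans_lt h)
  rw [Submodule.finrank_eq_zero, LinearMap.range_eq_bot] at h0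
  simpa using congr($h0 1)

/-- In large or zero characteristic, the kernel of the regular trace form is the Jacobson
radical. -/
lemma mem_jacobson_bot_iff_regularTrace
    (hchar : ringChar F = 0 ∨ Module.finrank F A < ringChar F) {a : A} :
    a ∈ (⊥ : Ideal A).jacobson ↔ ∀ b, regularTrace F A (a * b) = 0 := by
  refine ⟨regularTrace_mul_eq_zero_of_mem_jacobson, fun h => Ideal.mem_jacobson_iff.2 fun y => ?_⟩
  have hnil : IsNilpotent (y * a) := by
    by_contra hn
    obtain ⟨c, hc, hc0⟩ := exists_isIdempotentElem_mul (Algebra.IsIntegral.isIntegral (R := F) _) hn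
    refine hc0 (eq_zero_of_isIdempotentElem_of_regularTrace_eq_zero hchar hc ?_)
    rw [← mul_assoc, regularTrace_mul_comm, h]
  obtain ⟨u, hu⟩ := hnil.isUnit_one_add
  refine ⟨↑u⁻¹, ?_⟩
  rw [Ideal.mem_bot, sub_eq_zero, mul_assoc, ← mul_add_one, add_comm, ← hu, Units.inv_mul]

end TraceForm

section Comatrix

variable {F A H ι : Type*} [Field F] [AddCommGroup A] [Module F A]

/-- The coordinate of an element of `A ⊗ H` along the `i`-th vector of a basis of `A`. -/
noncomputable def tensorCoord [AddCommGroup H] [Module F H] (b : Module.Basis ι F A) (i : ι) :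
    A ⊗[F] H →ₗ[F] H :=
  (TensorProduct.lid F H).toLinearMap ∘ₗ LinearMap.rTensor H (b.coord i)

@[simp]
lemma tensorCoord_tmul [AddCommGroup H] [Module F H] (b : Module.Basis ι F A) (i : ι)
    (a : A) (h : H) : tensorCoord b i (a ⊗ₜ[F] h) = b.repr a i • h := by
  simp [tensorCoord]

/-- The matrix of coefficients of a coaction with respect to a basis of the comodule. -/
noncomputable def comatrix [AddCommGroup H] [Module F H] (b : Module.Basis ι F A)
    (ρ : A →ₗ[F] A ⊗[F] H) : Matrix ι ι H :=
  .of fun i j => tensorCoord b i (ρ (b j))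

variable [Fintype ι]

lemma sum_tmul_tensorCoord [AddCommGroup H] [Module F H] (b : Module.Basis ι F A)
    (z : A ⊗[F] H) : ∑ i, b i ⊗ₜ[F] tensorCoord b i z = z := by
  induction z with
  | zero => simp
  | tmul a h => simp_rw [tensorCoord_tmul, ← TensorProduct.smul_tmul, ← TensorProduct.sum_tmul,
      b.sum_repr]
  | add x y hx hy => simp_rw [map_add, TensorProduct.tmul_add, Finset.sum_add_distrib, hx, hy]

lemma sum_tmul_comatrix [AddCommGroup H] [Module F H] (b : Module.Basis ι F A)
    (ρ : A →ₗ[F] A ⊗[F] H) (j : ι) : ∑ i, b i ⊗ₜ[F] comatrix b ρ i j = ρ (b j) :=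
  sum_tmul_tensorCoord b _

lemma comul_comatrix [AddCommGroup H] [Module F H] [Coalgebra F H] (b : Module.Basis ι F A)
    (ρ : A →ₗ[F] A ⊗[F] H)
    (hcoassoc : ∀ a, TensorProduct.assoc F A H H (LinearMap.rTensor H ρ (ρ a)) =
      LinearMap.lTensor A (Coalgebra.comul (R := F) (A := H)) (ρ a)) (i j : ι) :
    Coalgebra.comul (R := F) (comatrix b ρ i j) =
      ∑ k, comatrix b ρ i k ⊗ₜ[F] comatrix b ρ k j := by
  classical
  have h := congr(tensorCoord b i $(hcoassoc (b j)))
  rw [← sum_tmul_comatrix b ρ j] at h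
  simp_rw [map_sum, LinearMap.rTensor_tmul, LinearMap.lTensor_tmul, ← sum_tmul_comatrix b ρ,
    TensorProduct.sum_tmul, map_sum, TensorProduct.assoc_tmul, tensorCoord_tmul] at h
  simpa [Finsupp.single_apply] using h.symm

lemma counit_comatrix [DecidableEq ι] [AddCommGroup H] [Module F H] [Coalgebra F H]
    (b : Module.Basis ι F A) (ρ : A →ₗ[F] A ⊗[F] H)
    (hcounit : ∀ a, TensorProduct.rid F A
      (LinearMap.lTensor A (Coalgebra.counit (R := F) (A := H)) (ρ a)) = a) (i j : ι) :
    Coalgebra.counit (R := F) (comatrix b ρ i j) = (1 : Matrix ι ι F) i j := by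
  have h := congr(b.repr $(hcounit (b j)) i)
  rw [← sum_tmul_comatrix b ρ j] at h
  simpa [Finsupp.single_apply, Matrix.one_apply, eq_comm] using h

lemma comatrix_mul_map_antipode [DecidableEq ι] [Ring H] [HopfAlgebra F H]
    (b : Module.Basis ι F A) (ρ : A →ₗ[F] A ⊗[F] H)
    (hcoassoc : ∀ a, TensorProduct.assoc F A H H (LinearMap.rTensor H ρ (ρ a)) =
      LinearMap.lTensor A (Coalgebra.comul (R := F) (A := H)) (ρ a))
    (hcounit : ∀ a, TensorProduct.rid F A
      (LinearMap.lTensor A (Coalgebra.counit (R := F) (A := H)) (ρ a)) = a) :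
    comatrix b ρ * (comatrix b ρ).map (HopfAlgebra.antipode F) = 1 := by
  ext i j
  have h := HopfAlgebra.mul_antipode_lTensor_comul_apply (R := F) (comatrix b ρ i j)
  rw [comul_comatrix b ρ hcoassoc, counit_comatrix b ρ hcounit] at h
  rw [Matrix.mul_apply]
  simpa [Matrix.one_apply, apply_ite] using h

end Comatrix

section ComoduleAlgebra

variable {F A H ι : Type*} [Field F] [Ring A] [Algebra F A] [Ring H]

/-- The regular trace applied to the left factor of `A ⊗ H`. -/
noncomputable def tensorTrace [Algebra F H] : A ⊗[F] H →ₗ[F] H :=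
  (TensorProduct.lid F H).toLinearMap ∘ₗ LinearMap.rTensor H (regularTrace F A)

@[simp]
lemma tensorTrace_tmul [Algebra F H] (a : A) (h : H) :
    tensorTrace (a ⊗ₜ[F] h) = regularTrace F A a • h := by
  simp [tensorTrace]

lemma tensorTrace_mul_one_tmul [Algebra F H] (z : A ⊗[F] H) (h : H) :
    tensorTrace (z * (1 : A) ⊗ₜ[F] h) = tensorTrace z * h := by
  induction z with
  | zero => simp
  | tmul a g => simp
  | add x y hx hy => simp_rw [add_mul, map_add, hx, hy, add_mul]

lemma tensorCoord_mul_one_tmul [Algebra F H] (b : Module.Basis ι F A) (i : ι)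
    (z : A ⊗[F] H) (h : H) :
    tensorCoord b i (z * (1 : A) ⊗ₜ[F] h) = tensorCoord b i z * h := by
  induction z with
  | zero => simp
  | tmul a g => simp
  | add x y hx hy => simp_rw [add_mul, map_add, hx, hy, add_mul]

lemma tensorTrace_eq_sum [Algebra F H] [Fintype ι] (b : Module.Basis ι F A) (z : A ⊗[F] H) :
    tensorTrace z = ∑ i, tensorCoord b i (z * b i ⊗ₜ[F] (1 : H)) := by
  classical
  induction z with
  | zero => simp
  | tmul a g =>
    simp [regularTrace_apply, LinearMap.trace_eq_matrix_trace F b, Matrix.trace,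
      LinearMap.toMatrix_apply, Finset.sum_smul]
  | add x y hx hy => simp_rw [add_mul, map_add, hx, hy, Finset.sum_add_distrib]

variable [HopfAlgebra F H] (ρ : A →ₐ[F] A ⊗[F] H)

lemma sum_mul_comatrix [Fintype ι] (b : Module.Basis ι F A) (z : A ⊗[F] H) (j : ι) :
    ∑ k, (z * b k ⊗ₜ[F] (1 : H)) * (1 : A) ⊗ₜ[F] comatrix b ρ.toLinearMap k j =
      z * ρ (b j) := by
  rw [← AlgHom.toLinearMap_apply, ← sum_tmul_comatrix b ρ.toLinearMap j, Finset.mul_sum]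
  simp [mul_assoc]

variable [FiniteDimensional F A]

/-- The regular trace is invariant under the coaction of an involutory Hopf algebra. -/
lemma tensorTrace_coaction
    (hcoassoc : ∀ a, TensorProduct.assoc F A H H (LinearMap.rTensor H ρ.toLinearMap (ρ a)) =
      LinearMap.lTensor A (Coalgebra.comul (R := F) (A := H)) (ρ a))
    (hcounit : ∀ a, TensorProduct.rid F A
      (LinearMap.lTensor A (Coalgebra.counit (R := F) (A := H)) (ρ a)) = a)
    (hinv : ∀ h : H, HopfAlgebra.antipode F (HopfAlgebra.antipode F h) = h) (a : A) :
    tensorTrace (ρ a) = algebraMap F H (regularTrace F A a) := by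
  classical
  set b := Module.finBasis F A
  set C := comatrix b ρ.toLinearMap
  have hCS : C * C.map (HopfAlgebra.antipode F) = 1 :=
    comatrix_mul_map_antipode b ρ.toLinearMap hcoassoc hcounit
  have hSC (j k) : ∑ i, C i k * HopfAlgebra.antipode F (C j i) = (1 : Matrix _ _ H) j k := by
    have h := congr(HopfAlgebra.antipode F ($hCS j k))
    simp_rw [Matrix.mul_apply, Matrix.map_apply, map_sum,
      HopfAlgebra.antipode_mul_antidistrib, hinv] at h
    rw [h, Matrix.one_apply]
    split_ifs <;> simp
  let L : Matrix _ _ F := LinearMap.toMatrix b b (Algebra.lmul F A a)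
  let M : Matrix _ _ H := .of fun i k => tensorCoord b i (ρ a * b k ⊗ₜ[F] (1 : H))
  have hMC : M * C = C * L.map (algebraMap F H) := by
    ext i j
    have h : ρ a * ρ (b j) = ∑ k, L k j • ρ (b k) := by
      rw [← map_mul]
      simp_rw [← map_smul, ← map_sum]
      congr 1
      simp [L, LinearMap.toMatrix_apply, b.sum_repr]
    have h' := congr(tensorCoord b i $h)
    rw [← sum_mul_comatrix ρ b] at h'
    simp_rw [map_sum, tensorCoord_mul_one_tmul, map_smul] at h'
    simp_rw [Matrix.mul_apply, Matrix.map_apply, ← Algebra.commutes, ← Algebra.smul_def]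
    exact h'
  have hM : M = C * L.map (algebraMap F H) * C.map (HopfAlgebra.antipode F) := by
    rw [← hMC, Matrix.mul_assoc, hCS, Matrix.mul_one]
  rw [tensorTrace_eq_sum b]
  change ∑ i, M i i = _
  simp_rw [hM, Matrix.mul_apply, Matrix.map_apply, Finset.sum_mul, ← Algebra.commutes, mul_assoc]
  rw [Finset.sum_comm]
  simp_rw [Finset.sum_comm (f := fun i k => algebraMap F H _ * (C i k * _)), ← Finset.mul_sum, hSC]
  simp [Matrix.one_apply, regularTrace_apply, LinearMap.trace_eq_matrix_trace F b, Matrix.trace, L]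

/-- The regular trace form annihilates the coefficients of the coaction on the radical. -/
lemma tensorTrace_coaction_mul_eq_zero
    (hcoassoc : ∀ a, TensorProduct.assoc F A H H (LinearMap.rTensor H ρ.toLinearMap (ρ a)) =
      LinearMap.lTensor A (Coalgebra.comul (R := F) (A := H)) (ρ a))
    (hcounit : ∀ a, TensorProduct.rid F A
      (LinearMap.lTensor A (Coalgebra.counit (R := F) (A := H)) (ρ a)) = a)
    (hinv : ∀ h : H, HopfAlgebra.antipode F (HopfAlgebra.antipode F h) = h)
    {a : A} (ha : ∀ b, regularTrace F A (a * b) = 0) (x : A) :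
    tensorTrace (ρ a * x ⊗ₜ[F] (1 : H)) = 0 := by
  classical
  set b := Module.finBasis F A
  set C := comatrix b ρ.toLinearMap
  have hCS : C * C.map (HopfAlgebra.antipode F) = 1 :=
    comatrix_mul_map_antipode b ρ.toLinearMap hcoassoc hcounit
  let v : Fin (Module.finrank F A) → H := fun i => tensorTrace (ρ a * b i ⊗ₜ[F] (1 : H))
  have hvC : Matrix.vecMul v C = 0 := by
    ext j
    have h := tensorTrace_coaction ρ hcoassoc hcounit hinv (a * b j)
    rw [ha, map_zero, map_mul, ← sum_mul_comatrix ρ b] at h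
    simp_rw [map_sum, tensorTrace_mul_one_tmul] at h
    exact h
  have hv : v = 0 := by
    rw [← Matrix.vecMul_one v, ← hCS, ← Matrix.vecMul_vecMul, hvC, Matrix.zero_vecMul]
  rw [← b.sum_repr x]
  simp_rw [TensorProduct.sum_tmul, ← TensorProduct.smul_tmul', Finset.mul_sum, mul_smul_comm,
    map_sum, map_smul]
  refine Finset.sum_eq_zero fun i _ => ?_
  have hi : tensorTrace (ρ a * b i ⊗ₜ[F] (1 : H)) = 0 := congr_fun hv i
  rw [hi, smul_zero]

end ComoduleAlgebra

/-- for a finite-dimensional `H`-comodule algebra `A` over an involutory Hopf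
algebra `H`, where `char F = 0` or `char F > dim_F A`, the Jacobson radical `J(A)` is an
`H`-subcomodule of `A`. -/
theorem stmt5 {F : Type*} [Field F] {H : Type*} [Ring H] [HopfAlgebra F H]
    {A : Type*} [Ring A] [Algebra F A] [FiniteDimensional F A]
    (ρ : A →ₐ[F] A ⊗[F] H)
    (hcoassoc : ∀ a : A, (TensorProduct.assoc F A H H)
        ((LinearMap.rTensor H ρ.toLinearMap) (ρ a))
      = (LinearMap.lTensor A (Coalgebra.comul (R := F) (A := H))) (ρ a))
    (hcounit : ∀ a : A, (TensorProduct.rid F A)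
        ((LinearMap.lTensor A (Coalgebra.counit (R := F) (A := H))) (ρ a)) = a)
    (hinv : ∀ h : H, HopfAlgebra.antipode (R := F)
      (HopfAlgebra.antipode (R := F) h) = h)
    (hchar : ringChar F = 0 ∨ Module.finrank F A < ringChar F) :
    IsSubcomodule ρ.toLinearMap
      (Submodule.restrictScalars F ((⊥ : Ideal A).jacobson)) := by
  intro a ha
  have ha' := (mem_jacobson_bot_iff_regularTrace hchar).1 ha
  let B := Module.Basis.ofVectorSpace F H
  obtain ⟨d, hd⟩ := TensorProduct.eq_repr_basis_right B (ρ a)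
  have hmem (i) : d i ∈ (⊥ : Ideal A).jacobson := by
    refine (mem_jacobson_bot_iff_regularTrace hchar).2 fun x => ?_
    have h := tensorTrace_coaction_mul_eq_zero ρ hcoassoc hcounit hinv ha' x
    rw [← hd, Finsupp.sum, Finset.sum_mul, map_sum] at h
    simp only [Algebra.TensorProduct.tmul_mul_tmul, mul_one, tensorTrace_tmul] at h
    by_cases hi : i ∈ d.support
    · exact linearIndependent_iff'.1 B.linearIndependent _ _ h i hi
    · rw [Finsupp.notMem_support_iff.1 hi, zero_mul, map_zero]
  rw [AlgHom.toLinearMap_apply, ← hd]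
  exact Submodule.sum_mem _ fun i _ => ⟨⟨d i, hmem i⟩ ⊗ₜ B i, rfl⟩
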